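/- arXiv:2604.08759 — 2 statements merged into one kernel-verified Lean document; each statement's English description precedes it below -/
import Mathlib

section
/- Let P_X be a non-decreasing probability distribution on {1,…,N} and define a(x) = min(α/T, P_X(x)). If a is not T-hot representable and there exists K ∈ {K̃,…,T−1} (where K̃ is the number of indices x with P_X(x) ≥ α/T) such that y := (1/(T−K)) Σ_{i=1}^{N−K} a(i) satisfies y ≥ a(N−K), then the vector P¹ = (a(1),…,a(N−K), y, …, y) (with K trailing entries equal to y) satisfies T · max_i P¹(i) = Σ_i P¹(i); in particular P¹ is T-hot representable. -/
/-- The maximum entry of a vector indexed by a nonempty `Fin N`. -/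
noncomputable def vecMax {N : ℕ} (hN : 0 < N) (a : Fin N → ℝ) : ℝ :=
  Finset.univ.sup' (Finset.univ_nonempty_iff.mpr (Fin.pos_iff_nonempty.mp hN)) a

theorem vecMax_eq_of_forall_le {N : ℕ} (hN : 0 < N) {v : Fin N → ℝ} {m : ℝ}
    (h : ∀ i, v i ≤ m) (j : Fin N) (hj : v j = m) : vecMax hN v = m :=
  le_antisymm (Finset.sup'_le _ _ fun i _ => h i)
    (hj ▸ Finset.le_sup' v (Finset.mem_univ j))

theorem sum_ite_val_lt_sub {N K : ℕ} (hKN : K ≤ N) (a : Fin N → ℝ) (y : ℝ) :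
    ∑ i : Fin N, (if (i : ℕ) < N - K then a i else y) =
      (∑ i ∈ Finset.univ.filter (fun i : Fin N => (i : ℕ) < N - K), a i) + K * y := by
  have hsplit := Finset.card_filter_add_card_filter_not (s := (Finset.univ : Finset (Fin N)))
    (fun i : Fin N => (i : ℕ) < N - K)
  have hlow : (Finset.univ.filter (fun i : Fin N => (i : ℕ) < N - K)).card = N - K := by
    rw [Fin.card_filter_val_lt]
    omega
  have hhigh : (Finset.univ.filter (fun i : Fin N => ¬ (i : ℕ) < N - K)).card = K := by
    rw [hlow, Finset.card_univ, Fintype.card_fin] at hsplit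
    omega
  rw [Finset.sum_ite, Finset.sum_const, hhigh, nsmul_eq_mul]

/-- Leveling the last `K` entries of `a = min(α/T, P_X)` to `y` yields a vector `P¹`
with `T · max_i P¹(i) = Σ_i P¹(i)`; in particular `P¹` is `T`-hot representable. -/
theorem stmt7 (N T : ℕ) (hT : 1 ≤ T) (hTN : T ≤ N)
    (α : ℝ) (hα0 : 0 ≤ α) (hα1 : α < 1)
    (PX : Fin N → ℝ) (hmono : Monotone PX) (hPX0 : ∀ i, 0 ≤ PX i) (hPX1 : ∑ i, PX i = 1)
    (a : Fin N → ℝ) (ha : ∀ i, a i = min (α / T) (PX i))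
    (Ktil : ℕ) (hKtil : Ktil = (Finset.univ.filter (fun i : Fin N => α / T ≤ PX i)).card)
    (hnotrep : ∑ i, a i < (T : ℝ) * vecMax (lt_of_lt_of_le hT hTN) a)
    (K : ℕ) (hK1 : Ktil ≤ K) (hK2 : K ≤ T - 1)
    (y : ℝ)
    (hy : y = (1 / ((T : ℝ) - K)) *
      ∑ i ∈ Finset.univ.filter (fun i : Fin N => (i : ℕ) < N - K), a i)
    (hlev : a ⟨N - K - 1, by omega⟩ ≤ y)
    (P1 : Fin N → ℝ) (hP1 : ∀ i, P1 i = if (i : ℕ) < N - K then a i else y) :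
    (T : ℝ) * vecMax (lt_of_lt_of_le hT hTN) P1 = ∑ i, P1 i ∧
      (T : ℝ) * vecMax (lt_of_lt_of_le hT hTN) P1 ≤ ∑ i, P1 i := by
  have hN : 0 < N := lt_of_lt_of_le hT hTN
  have hKT : K < T := by omega
  have ha_mono : Monotone a := fun i j hij => by
    rw [ha, ha]
    exact min_le_min_left _ (hmono hij)
  have hsum : ∑ i, P1 i = T * y := by
    have hTK : (T : ℝ) - K ≠ 0 := sub_ne_zero.mpr (by exact_mod_cast hKT.ne')
    have hlow : ∑ i ∈ Finset.univ.filter (fun i : Fin N => (i : ℕ) < N - K), a i =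
        ((T : ℝ) - K) * y := by
      rw [hy]
      field_simp
    rw [Finset.sum_congr rfl fun i _ => hP1 i, sum_ite_val_lt_sub (by omega), hlow]
    ring
  have hle : ∀ i, P1 i ≤ y := fun i => by
    rw [hP1]
    split_ifs with hi
    · refine (ha_mono ?_).trans hlev
      rw [Fin.le_def]
      show (i : ℕ) ≤ N - K - 1
      omega
    · exact le_rfl
  have hKpos : 0 < K := by
    refine Nat.pos_of_ne_zero fun hK => ?_
    subst hK
    have hP1a : P1 = a := funext fun i => by rw [hP1, if_pos (by simp)]
    have hmax : vecMax hN a ≤ y := Finset.sup'_le _ _ fun i _ => hP1a ▸ hle i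
    rw [hP1a] at hsum
    exact (hnotrep.trans_le (mul_le_mul_of_nonneg_left hmax T.cast_nonneg)).ne hsum
  have hmax : vecMax hN P1 = y :=
    vecMax_eq_of_forall_le hN hle ⟨N - 1, by omega⟩ <| by
      rw [hP1, if_neg]
      show ¬ N - 1 < N - K
      omega
  have heq : (T : ℝ) * vecMax hN P1 = ∑ i, P1 i := by rw [hmax, hsum]
  exact ⟨heq, heq.le⟩
end

section
/- Let P_X be a non-decreasing probability distribution of length N and a(i) = min(α/T, P_X(i)) with K̃ = #{i : P_X(i) ≥ α/T}. If the leveling procedure terminates at K = K̃, i.e. y = (1/(T−K̃)) Σ_{i=1}^{N−K̃} a(i) ≥ a(N−K̃), and a is not T-hot representable, then y < α/T. -/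
/-- If the leveling procedure terminates at `K = K̃` and `a` is not `T`-hot
representable, then the leveling value `y` satisfies `y < α/T`. -/
theorem stmt9 (N T : ℕ) (hT : 1 ≤ T) (hTN : T ≤ N)
    (α : ℝ) (hα0 : 0 ≤ α) (hα1 : α < 1)
    (PX : Fin N → ℝ) (hmono : Monotone PX) (hPX0 : ∀ i, 0 ≤ PX i) (hPX1 : ∑ i, PX i = 1)
    (a : Fin N → ℝ) (ha : ∀ i, a i = min (α / T) (PX i))
    (Ktil : ℕ) (hKtil : Ktil = (Finset.univ.filter (fun i : Fin N => α / T ≤ PX i)).card)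
    (hKT : Ktil < T)
    (htail : ∀ i : Fin N, N - Ktil ≤ (i : ℕ) → a i = α / T)
    (hnotrep : ∑ i, a i < (T : ℝ) * vecMax (lt_of_lt_of_le hT hTN) a)
    (y : ℝ)
    (hy : y = (1 / ((T : ℝ) - Ktil)) *
      ∑ i ∈ Finset.univ.filter (fun i : Fin N => (i : ℕ) < N - Ktil), a i)
    (hlev : a ⟨N - Ktil - 1, by omega⟩ ≤ y) :
    y < α / T := by
  have hTpos : (0 : ℝ) < T := by exact_mod_cast hT
  have hgap : (0 : ℝ) < (T : ℝ) - Ktil := sub_pos.mpr (by exact_mod_cast hKT)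
  have hmax : vecMax (lt_of_lt_of_le hT hTN) a ≤ α / T :=
    Finset.sup'_le _ _ fun i _ => (ha i).trans_le (min_le_left _ _)
  have htail_card :
      (Finset.univ.filter (fun i : Fin N => ¬ (i : ℕ) < N - Ktil)).card = Ktil := by
    have hsplit := Finset.card_filter_add_card_filter_not
      (s := (Finset.univ : Finset (Fin N))) (fun i : Fin N => (i : ℕ) < N - Ktil)
    rw [Fin.card_filter_val_lt, Finset.card_univ, Fintype.card_fin] at hsplit
    omega
  have htail_sum :
      ∑ i ∈ Finset.univ.filter (fun i : Fin N => ¬ (i : ℕ) < N - Ktil), a i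
        = Ktil * (α / T) := by
    rw [Finset.sum_congr rfl fun i hi => htail i (not_lt.mp (Finset.mem_filter.mp hi).2),
      Finset.sum_const, htail_card, nsmul_eq_mul]
  have hsum := Finset.sum_filter_add_sum_filter_not Finset.univ
    (fun i : Fin N => (i : ℕ) < N - Ktil) a
  have hbound := mul_le_mul_of_nonneg_left hmax hTpos.le
  rw [hy, one_div, inv_mul_lt_iff₀ hgap]
  linarith
end
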